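/- arXiv:2210.15614 — 9 statements merged into one kernel-verified Lean document; each statement's English description precedes it below -/
import Mathlib

section
/- Let c ≥ 2 and let z : Fin c → ℝ be injective. For each index i define the transformed score t(i) = ((∑_{j ≠ i} sgn(z i − z j)) − (c − 2)) / (2c − 2), where sgn denotes the real sign function. Then t(i) ∈ [−1, 1/(2c−2)] for every i; t(i) = 1/(2c−2) if z i is the maximum of z; and t(i) ≤ −1/(2c−2) for every i whose value z i is not the maximum. -/
open Finset in
/-- For `c ≥ 2` and injective logits `z : Fin c → ℝ`, the transformed score
`t i = ((∑_{j ≠ i} sgn (z i − z j)) − (c − 2)) / (2c − 2)` lies in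
`[−1, 1/(2c−2)]` for every `i`; equals `1/(2c−2)` when `z i` is the maximum;
and is at most `−1/(2c−2)` when `z i` is not the maximum. -/
theorem stmt_2 (c : ℕ) (hc : 2 ≤ c) (z : Fin c → ℝ) (hz : Function.Injective z)
    (t : Fin c → ℝ)
    (ht : ∀ i, t i =
      ((∑ j ∈ Finset.univ.erase i, Real.sign (z i - z j)) - ((c : ℝ) - 2)) /
        (2 * (c : ℝ) - 2)) :
    (∀ i, t i ∈ Set.Icc (-1 : ℝ) (1 / (2 * (c : ℝ) - 2))) ∧
    (∀ i, (∀ j, z j ≤ z i) → t i = 1 / (2 * (c : ℝ) - 2)) ∧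
    (∀ i, ¬ (∀ j, z j ≤ z i) → t i ≤ -(1 / (2 * (c : ℝ) - 2))) := by
  have hc' : (2 : ℝ) ≤ c := by exact_mod_cast hc
  have hpos : (0 : ℝ) < 2 * (c : ℝ) - 2 := by linarith
  have hle : ∀ x : ℝ, Real.sign x ≤ 1 := by
    intro x
    rcases Real.sign_apply_eq x with h | h | h <;> rw [h] <;> norm_num
  have hge : ∀ x : ℝ, -1 ≤ Real.sign x := by
    intro x
    rcases Real.sign_apply_eq x with h | h | h <;> rw [h] <;> norm_num
  have hcard : ∀ i : Fin c, (((Finset.univ.erase i).card : ℕ) : ℝ) = (c : ℝ) - 1 := by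
    intro i
    rw [Finset.card_erase_of_mem (Finset.mem_univ i), Finset.card_univ, Fintype.card_fin,
      Nat.cast_sub (by omega)]
    simp
  have hub : ∀ i, ∑ j ∈ Finset.univ.erase i, Real.sign (z i - z j) ≤ (c : ℝ) - 1 := by
    intro i
    have h := Finset.sum_le_card_nsmul (Finset.univ.erase i)
      (fun j => Real.sign (z i - z j)) 1 (fun j _ => hle _)
    rw [nsmul_eq_mul, hcard] at h
    linarith
  have hlb : ∀ i, -((c : ℝ) - 1) ≤ ∑ j ∈ Finset.univ.erase i, Real.sign (z i - z j) := by
    intro i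
    have h := Finset.card_nsmul_le_sum (Finset.univ.erase i)
      (fun j => Real.sign (z i - z j)) (-1) (fun j _ => hge _)
    rw [nsmul_eq_mul, hcard] at h
    linarith
  refine ⟨fun i => ⟨?_, ?_⟩, fun i hi => ?_, fun i hi => ?_⟩
  · rw [ht, le_div_iff₀ hpos]
    linarith [hlb i]
  · rw [ht]
    apply div_le_div_of_nonneg_right _ hpos.le
    linarith [hub i]
  · have h : ∑ j ∈ Finset.univ.erase i, Real.sign (z i - z j) = (c : ℝ) - 1 := by
      rw [Finset.sum_congr rfl (g := fun _ => (1 : ℝ)), Finset.sum_const, nsmul_eq_mul, hcard]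
      · ring
      · intro j hj
        apply Real.sign_of_pos
        have h1 : z j ≠ z i := fun h => Finset.ne_of_mem_erase hj (hz h)
        linarith [lt_of_le_of_ne (hi j) h1]
    rw [ht, h]
    congr 1
    ring
  · push Not at hi
    obtain ⟨k, hk⟩ := hi
    have hki : k ∈ Finset.univ.erase i := by
      refine Finset.mem_erase.2 ⟨?_, Finset.mem_univ _⟩
      rintro rfl
      exact lt_irrefl _ hk
    have h := Finset.sum_le_card_nsmul ((Finset.univ.erase i).erase k)
      (fun j => Real.sign (z i - z j)) 1 (fun j _ => hle _)
    have h2 := Finset.add_sum_erase (Finset.univ.erase i)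
      (fun j => Real.sign (z i - z j)) hki
    have h3 : Real.sign (z i - z k) = -1 := Real.sign_of_neg (by linarith)
    have h4 : ((((Finset.univ.erase i).erase k).card : ℕ) : ℝ) + 1 = (c : ℝ) - 1 := by
      rw [← hcard i, ← Finset.card_erase_add_one hki]
      push_cast
      rfl
    rw [nsmul_eq_mul] at h
    simp only [h3] at h2
    rw [ht, ← neg_div]
    apply div_le_div_of_nonneg_right _ hpos.le
    linarith
end

section
/- Let c ≥ 2 and let z : Fin c → ℝ be injective. For each index i let t(i) = ((∑_{j ≠ i} sgn(z i − z j)) − (c − 2)) / (2c − 2) and define y(i) = (sgn(t(i)) + 1)/2. Then y is the one-hot indicator of the argmax of z: y(i) = 1 if z i is the maximum of z, and y(i) = 0 otherwise. -/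
/-- For `c ≥ 2` and injective logits `z : Fin c → ℝ`, with transformed scores
`t i = ((∑_{j ≠ i} sgn (z i − z j)) − (c − 2)) / (2c − 2)` and
`y i = (sgn (t i) + 1)/2`, the vector `y` is the one-hot indicator of the
argmax of `z`. -/
theorem stmt_3 (c : ℕ) (hc : 2 ≤ c) (z : Fin c → ℝ) (hz : Function.Injective z)
    (t : Fin c → ℝ)
    (ht : ∀ i, t i =
      ((∑ j ∈ Finset.univ.erase i, Real.sign (z i - z j)) - ((c : ℝ) - 2)) /
        (2 * (c : ℝ) - 2))
    (y : Fin c → ℝ)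
    (hy : ∀ i, y i = (Real.sign (t i) + 1) / 2) :
    ∀ i, (((∀ j, z j ≤ z i) → y i = 1) ∧ (¬ (∀ j, z j ≤ z i) → y i = 0)) := by
  have hc' : (2 : ℝ) ≤ c := by exact_mod_cast hc
  have hpos : (0 : ℝ) < 2 * (c : ℝ) - 2 := by linarith
  have hcard : ∀ i : Fin c, (((Finset.univ.erase i).card : ℕ) : ℝ) = (c : ℝ) - 1 := by
    intro i
    rw [Finset.card_erase_of_mem (Finset.mem_univ i), Finset.card_univ, Fintype.card_fin,
      Nat.cast_sub (by omega)]
    simp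
  intro i
  constructor
  · intro h
    have hs : ∑ j ∈ Finset.univ.erase i, Real.sign (z i - z j) = (c : ℝ) - 1 := by
      rw [← hcard i, Finset.cast_card]
      refine Finset.sum_congr rfl fun j hj => ?_
      apply Real.sign_of_pos
      have hne : z j ≠ z i := fun e => Finset.ne_of_mem_erase hj (hz e)
      have := lt_of_le_of_ne (h j) hne
      linarith
    have htp : 0 < t i := by
      rw [ht, hs]
      apply div_pos _ hpos
      linarith
    rw [hy, Real.sign_of_pos htp]
    norm_num
  · intro h
    push Not at h
    obtain ⟨k, hk⟩ := h
    have hki : k ∈ Finset.univ.erase i := by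
      refine Finset.mem_erase.2 ⟨?_, Finset.mem_univ k⟩
      rintro rfl
      exact lt_irrefl _ hk
    have hle : ∀ x : ℝ, Real.sign x ≤ 1 := by
      intro x
      rcases Real.sign_apply_eq x with e | e | e <;> rw [e] <;> norm_num
    have hs : ∑ j ∈ (Finset.univ.erase i).erase k, Real.sign (z i - z j) ≤ (c : ℝ) - 2 := by
      have h1 := Finset.sum_le_card_nsmul ((Finset.univ.erase i).erase k)
        (fun j => Real.sign (z i - z j)) 1 (fun j _ => hle _)
      have h2 := Finset.card_erase_add_one hki
      have h3 : ((((Finset.univ.erase i).erase k).card : ℕ) : ℝ) + 1 = (c : ℝ) - 1 := by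
        rw [← hcard i]
        exact_mod_cast h2
      rw [nsmul_eq_mul, mul_one] at h1
      linarith
    have hadd := Finset.add_sum_erase _ (fun j => Real.sign (z i - z j)) hki
    have hneg : Real.sign (z i - z k) = -1 := Real.sign_of_neg (by linarith)
    have htn : t i < 0 := by
      rw [ht]
      apply div_neg_of_neg_of_pos _ hpos
      simp only [hneg] at hadd
      linarith
    rw [hy, Real.sign_of_neg htn]
    norm_num
end

section
/- Let c ≥ 2, let z : Fin c → ℝ be injective, and let ψ > 0 be a real number with (c − 1)·2^{−ψ} < 1. Suppose s : Fin c → Fin c → ℝ satisfies, for all i ≠ j: s(i,j) ∈ [1 − 2^{−ψ}, 1] whenever z i > z j, and s(i,j) ∈ [−1, −1 + 2^{−ψ}] whenever z i < z j. Define t(i) = ((∑_{j ≠ i} s(i,j)) − (c − 2)) / (2c − 2) and φ₂ = (1 − (c − 1)·2^{−ψ}) / (2c − 2). Then t(i) ∈ [−1, 1/(2c−2)] for every i; if z i* is the maximum of z then t(i*) ≥ φ₂ > 0; and for every i with z i not the maximum, t(i) ≤ −(1 − 2^{−ψ})/(2c − 2) ≤ −φ₂ < 0. -/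
/-- For `c ≥ 2`, injective logits `z`, precision `ψ > 0` with `(c−1)·2^{−ψ} < 1`,
and approximate pairwise signs `s` (within `2^{−ψ}` of `±1` on distinct logits),
the transformed scores `t i = ((∑_{j ≠ i} s i j) − (c−2)) / (2c−2)` lie in
`[−1, 1/(2c−2)]`; the maximizing index gets `t ≥ φ₂ > 0` with
`φ₂ = (1 − (c−1)·2^{−ψ})/(2c−2)`, and every non-maximizing index gets
`t ≤ −(1 − 2^{−ψ})/(2c−2) ≤ −φ₂ < 0`. -/
theorem stmt_4 (c : ℕ) (hc : 2 ≤ c) (z : Fin c → ℝ) (hz : Function.Injective z)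
    (ψ : ℝ) (hψ : 0 < ψ) (hcψ : ((c : ℝ) - 1) * (2 : ℝ) ^ (-ψ) < 1)
    (s : Fin c → Fin c → ℝ)
    (hs_pos : ∀ i j, i ≠ j → z j < z i → s i j ∈ Set.Icc (1 - (2 : ℝ) ^ (-ψ)) 1)
    (hs_neg : ∀ i j, i ≠ j → z i < z j → s i j ∈ Set.Icc (-1 : ℝ) (-1 + (2 : ℝ) ^ (-ψ)))
    (t : Fin c → ℝ)
    (ht : ∀ i, t i =
      ((∑ j ∈ Finset.univ.erase i, s i j) - ((c : ℝ) - 2)) / (2 * (c : ℝ) - 2))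
    (φ₂ : ℝ) (hφ₂ : φ₂ = (1 - ((c : ℝ) - 1) * (2 : ℝ) ^ (-ψ)) / (2 * (c : ℝ) - 2)) :
    (∀ i, t i ∈ Set.Icc (-1 : ℝ) (1 / (2 * (c : ℝ) - 2))) ∧
    (∀ i, (∀ j, z j ≤ z i) → φ₂ ≤ t i) ∧ 0 < φ₂ ∧
    (∀ i, ¬ (∀ j, z j ≤ z i) →
      t i ≤ -(1 - (2 : ℝ) ^ (-ψ)) / (2 * (c : ℝ) - 2)) ∧
    -(1 - (2 : ℝ) ^ (-ψ)) / (2 * (c : ℝ) - 2) ≤ -φ₂ ∧ -φ₂ < 0 := by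
  have he0 : (0 : ℝ) < (2 : ℝ) ^ (-ψ) := Real.rpow_pos_of_pos (by norm_num) _
  have he1 : (2 : ℝ) ^ (-ψ) < 1 :=
    Real.rpow_lt_one_of_one_lt_of_neg (by norm_num) (by linarith)
  generalize (2 : ℝ) ^ (-ψ) = e at *
  have hc' : (2 : ℝ) ≤ c := by exact_mod_cast hc
  have hd : (0 : ℝ) < 2 * (c : ℝ) - 2 := by linarith
  have hb : ∀ i j, i ≠ j → -1 ≤ s i j ∧ s i j ≤ 1 := by
    intro i j hij
    rcases lt_or_gt_of_ne (fun h => hij (hz h)) with h | h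
    · have := hs_neg i j hij h
      exact ⟨this.1, by linarith [this.2]⟩
    · have := hs_pos i j hij h
      exact ⟨by linarith [this.1], this.2⟩
  have hcard : ∀ i : Fin c, ((Finset.univ.erase i).card : ℝ) = (c : ℝ) - 1 := by
    intro i
    rw [Finset.card_erase_of_mem (Finset.mem_univ i), Finset.card_univ, Fintype.card_fin,
      Nat.cast_sub (by omega), Nat.cast_one]
  have hlow : ∀ (i : Fin c) (a : ℝ), (∀ j, i ≠ j → a ≤ s i j) →
      ((c : ℝ) - 1) * a ≤ ∑ j ∈ Finset.univ.erase i, s i j := by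
    intro i a h
    have := Finset.card_nsmul_le_sum (Finset.univ.erase i) (s i) a
      (fun j hj => h j (Finset.ne_of_mem_erase hj).symm)
    rwa [nsmul_eq_mul, hcard] at this
  have hup : ∀ (i : Fin c), ∑ j ∈ Finset.univ.erase i, s i j ≤ (c : ℝ) - 1 := by
    intro i
    have := Finset.sum_le_card_nsmul (Finset.univ.erase i) (s i) 1
      (fun j hj => (hb i j (Finset.ne_of_mem_erase hj).symm).2)
    rwa [nsmul_eq_mul, hcard, mul_one] at this
  have hφ : 0 < φ₂ := by
    rw [hφ₂]
    exact div_pos (by linarith) hd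
  refine ⟨fun i => ⟨?_, ?_⟩, fun i hi => ?_, hφ, fun i hi => ?_, ?_, by linarith⟩
  · rw [ht, le_div_iff₀ hd]
    linarith [hlow i (-1) (fun j hj => (hb i j hj).1)]
  · rw [ht]
    exact div_le_div_of_nonneg_right (by linarith [hup i]) hd.le
  · rw [ht, hφ₂]
    refine div_le_div_of_nonneg_right ?_ hd.le
    have := hlow i (1 - e) (fun j hj =>
      (hs_pos i j hj (lt_of_le_of_ne (hi j) (fun h => hj (hz h).symm))).1)
    linarith
  · push Not at hi
    obtain ⟨k, hk⟩ := hi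
    have hik : i ≠ k := fun h => by simp [h] at hk
    rw [ht]
    refine div_le_div_of_nonneg_right ?_ hd.le
    have hkm : k ∈ Finset.univ.erase i := by simp [hik.symm]
    have h1 := Finset.add_sum_erase _ (s i) hkm
    have h2 := Finset.sum_le_card_nsmul ((Finset.univ.erase i).erase k) (s i) 1
      (fun j hj => (hb i j (Finset.ne_of_mem_erase (Finset.mem_of_mem_erase hj)).symm).2)
    have h3 : ((((Finset.univ.erase i).erase k).card : ℕ) : ℝ) = (c : ℝ) - 2 := by
      have := Finset.card_erase_add_one hkm
      have h4 := hcard i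
      rw [← this] at h4
      push_cast at h4
      linarith
    rw [nsmul_eq_mul, h3] at h2
    linarith [(hs_neg i k hik hk).2]
  · rw [hφ₂, ← neg_div]
    refine div_le_div_of_nonneg_right ?_ hd.le
    nlinarith
end

section
/- Let c ≥ 2, let z : Fin c → ℝ be injective with maximizing index i*, let D > 0 and ψ > 0 with (c − 1)·2^{−ψ} < 1, and suppose z i* − z j ≥ D for all j ≠ i* (in particular this holds if the gap between the largest and second-largest logit is at least D). Suppose s : Fin c → Fin c → ℝ satisfies, for all i ≠ j: s(i,j) ∈ [−1, 1]; s(i,j) ≥ 1 − 2^{−ψ} whenever z i − z j ≥ D; and s(i,j) ≤ −1 + 2^{−ψ} whenever z j − z i ≥ D. Define t(i) = ((∑_{j ≠ i} s(i,j)) − (c − 2)) / (2c − 2) and φ₂ = (1 − (c − 1)·2^{−ψ}) / (2c − 2). Then t(i*) ≥ φ₂ > 0, and for every i ≠ i*, t(i) ≤ (−1 + 2^{−ψ})/(2c − 2) ≤ −φ₂ < 0. Hence difference-condition violations among pairs not involving the top gap are harmless: the sign of every t(i) still correctly identifies the argmax with margin φ₂. -/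
/-- If the top logit `z i*` beats every other logit by at least `D`, and the
approximate signs `s` are within `2^{−ψ}` of `±1` whenever the logit gap is at
least `D` (and always in `[−1,1]`), then `t i* ≥ φ₂ > 0` and
`t i ≤ (−1 + 2^{−ψ})/(2c−2) ≤ −φ₂ < 0` for all `i ≠ i*`: difference-condition
violations not involving the top gap are harmless. -/
theorem stmt_7 (c : ℕ) (hc : 2 ≤ c) (z : Fin c → ℝ) (hz : Function.Injective z)
    (istar : Fin c) (hstar : ∀ j, z j ≤ z istar)
    (D : ℝ) (hD : 0 < D)
    (ψ : ℝ) (hψ : 0 < ψ) (hcψ : ((c : ℝ) - 1) * (2 : ℝ) ^ (-ψ) < 1)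
    (hgap : ∀ j, j ≠ istar → D ≤ z istar - z j)
    (s : Fin c → Fin c → ℝ)
    (hs_bdd : ∀ i j, i ≠ j → s i j ∈ Set.Icc (-1 : ℝ) 1)
    (hs_pos : ∀ i j, i ≠ j → D ≤ z i - z j → 1 - (2 : ℝ) ^ (-ψ) ≤ s i j)
    (hs_neg : ∀ i j, i ≠ j → D ≤ z j - z i → s i j ≤ -1 + (2 : ℝ) ^ (-ψ))
    (t : Fin c → ℝ)
    (ht : ∀ i, t i =
      ((∑ j ∈ Finset.univ.erase i, s i j) - ((c : ℝ) - 2)) / (2 * (c : ℝ) - 2))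
    (φ₂ : ℝ) (hφ₂ : φ₂ = (1 - ((c : ℝ) - 1) * (2 : ℝ) ^ (-ψ)) / (2 * (c : ℝ) - 2)) :
    φ₂ ≤ t istar ∧ 0 < φ₂ ∧
    (∀ i, i ≠ istar → t i ≤ (-1 + (2 : ℝ) ^ (-ψ)) / (2 * (c : ℝ) - 2)) ∧
    (-1 + (2 : ℝ) ^ (-ψ)) / (2 * (c : ℝ) - 2) ≤ -φ₂ ∧ -φ₂ < 0 := by
  have hc' : (2 : ℝ) ≤ c := by exact_mod_cast hc
  have he : 0 < (2 : ℝ) ^ (-ψ) := by positivity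
  generalize (2 : ℝ) ^ (-ψ) = e at *
  have hd : 0 < 2 * (c : ℝ) - 2 := by linarith
  have hpos : 0 < φ₂ := by
    rw [hφ₂]
    exact div_pos (by linarith) hd
  have hcard : ∀ i : Fin c, ((Finset.univ.erase i).card : ℝ) = (c : ℝ) - 1 := by
    intro i
    rw [Finset.card_erase_of_mem (Finset.mem_univ i), Finset.card_univ, Fintype.card_fin,
      Nat.cast_sub (by omega)]
    simp
  refine ⟨?_, hpos, ?_, ?_, by linarith⟩
  · rw [hφ₂, ht]
    refine div_le_div_of_nonneg_right ?_ hd.le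
    have h := Finset.card_nsmul_le_sum (Finset.univ.erase istar) (s istar) (1 - e) (by
      intro j hj
      have hj' := Finset.ne_of_mem_erase hj
      exact hs_pos _ _ hj'.symm (hgap j hj'))
    rw [nsmul_eq_mul, hcard] at h
    linarith
  · intro i hi
    rw [ht]
    refine div_le_div_of_nonneg_right ?_ hd.le
    have hm : istar ∈ Finset.univ.erase i := Finset.mem_erase.2 ⟨hi.symm, Finset.mem_univ _⟩
    rw [← Finset.add_sum_erase _ _ hm]
    have h1 := hs_neg i istar hi (hgap i hi)
    have h := Finset.sum_le_card_nsmul ((Finset.univ.erase i).erase istar) (s i) 1 (by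
      intro j hj
      have hj' := Finset.ne_of_mem_erase (Finset.mem_of_mem_erase hj)
      exact (hs_bdd i j hj'.symm).2)
    have h2 : (((Finset.univ.erase i).erase istar).card : ℝ) + 1 = (c : ℝ) - 1 := by
      rw [← hcard i]
      exact_mod_cast Finset.card_erase_add_one hm
    rw [nsmul_eq_mul] at h
    linarith
  · rw [hφ₂, ← neg_div]
    refine div_le_div_of_nonneg_right ?_ hd.le
    nlinarith
end

section
/- Let n ≥ 1 and c ≥ 1 be natural numbers and ε ≥ 0 a real number with n·ε < 1/2. Let k : Fin n → Fin c be a sequence of predicted classes and y : Fin n → Fin c → ℝ approximate one-hot vectors satisfying |y(i)(j) − (if k(i) = j then 1 else 0)| ≤ ε for all i and j. Then for every class j, the integer nearest to the aggregated sum ∑_{i} y(i)(j) is exactly the count #{i : k(i) = j}; i.e., round(∑_i y(i)(j)) = #{i : k(i) = j}. -/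
/-- If each approximate one-hot vector `y i` is entrywise within `ε` of the
exact one-hot encoding of the predicted class `k i`, and `n·ε < 1/2`, then
rounding the aggregated sums recovers the per-class counts:
`round (∑ i, y i j) = #{i : k i = j}` for every class `j`. -/
theorem stmt_8 (n c : ℕ) (hn : 1 ≤ n) (hc : 1 ≤ c)
    (ε : ℝ) (hε : 0 ≤ ε) (hnε : (n : ℝ) * ε < 1 / 2)
    (k : Fin n → Fin c) (y : Fin n → Fin c → ℝ)
    (hy : ∀ i j, |y i j - (if k i = j then (1 : ℝ) else 0)| ≤ ε) :
    ∀ j, round (∑ i, y i j) =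
      ((Finset.univ.filter (fun i => k i = j)).card : ℤ) := by
  intro j
  have h1 : |∑ i, (y i j - (if k i = j then (1 : ℝ) else 0))| ≤ (n : ℝ) * ε := by
    refine (Finset.abs_sum_le_sum_abs _ _).trans ?_
    refine (Finset.sum_le_sum (fun i _ => hy i j)).trans ?_
    simp
  rw [Finset.sum_sub_distrib, Finset.sum_boole, abs_le] at h1
  rw [round_eq_iff, Set.mem_Ico, Int.cast_natCast]
  constructor <;> linarith [h1.1, h1.2]
end

section
/- Let d ≥ 1 and c ≥ 1 be natural numbers, let Θ be a symmetric positive definite real d×d matrix, let L > 0 be a real number, let F : ℝ^d → Fin c be any function, and let x ∈ ℝ^d. Then the following are equivalent: (i) for all x' ∈ ℝ^d, (if F(x') ≠ F(x) then 1 else 0) ≤ L · (x − x')ᵀ Θ (x − x') (metric fairness of F at x with Lipschitz constant L and Mahalanobis input metric); (ii) for all δ ∈ ℝ^d with δᵀ Θ δ < 1/L (equivalently ‖δ‖_Θ < √(1/L)), F(x + δ) = F(x) (local robustness of F at x in the Mahalanobis ball of radius √(1/L)). -/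
open Matrix

/-- Metric individual fairness of `F` at `x` with Lipschitz constant `L` and
Mahalanobis input metric given by a symmetric positive definite matrix `Θ` is
equivalent to local robustness of `F` at `x` in the Mahalanobis ball of radius
`√(1/L)`. -/
theorem stmt_9 (d c : ℕ) (hd : 1 ≤ d) (hc : 1 ≤ c)
    (Θ : Matrix (Fin d) (Fin d) ℝ) (hΘ : Θ.PosDef)
    (L : ℝ) (hL : 0 < L)
    (F : (Fin d → ℝ) → Fin c) (x : Fin d → ℝ) :
    (∀ x' : Fin d → ℝ,
        (if F x' ≠ F x then (1 : ℝ) else 0) ≤ L * ((x - x') ⬝ᵥ Θ *ᵥ (x - x'))) ↔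
    (∀ δ : Fin d → ℝ, δ ⬝ᵥ Θ *ᵥ δ < 1 / L → F (x + δ) = F x) := by
  have key : ∀ δ : Fin d → ℝ, (-δ) ⬝ᵥ Θ *ᵥ (-δ) = δ ⬝ᵥ Θ *ᵥ δ := by
    intro δ
    simp [Matrix.mulVec_neg]
  constructor
  · intro h δ hδ
    by_contra hne
    have h1 := h (x + δ)
    have e : x - (x + δ) = -δ := by abel
    rw [if_pos hne, e, key] at h1
    rw [lt_div_iff₀ hL] at hδ
    linarith
  · intro h x'
    split_ifs with hne
    · by_contra hlt
      push Not at hlt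
      apply hne
      have e : x - x' = -(x' - x) := by abel
      rw [e, key] at hlt
      have h1 := h (x' - x) (by rw [lt_div_iff₀ hL]; linarith)
      rwa [add_sub_cancel] at h1
    · have h0 := hΘ.posSemidef.dotProduct_mulVec_nonneg (x - x')
      rw [star_trivial] at h0
      exact mul_nonneg hL.le h0
end

section
/- Let d ≥ 1 and c ≥ 1 be natural numbers, σ > 0 and R > 0 real numbers, F : ℝ^d → Fin c a measurable function, and let μ be the Gaussian measure N(0, σ²·I_d) on ℝ^d. Fix x ∈ ℝ^d and a class k ∈ Fin c, and suppose μ{v : F(x + v) = k} ≥ Φ(R/σ), where Φ is the standard normal cumulative distribution function. Then for every δ ∈ ℝ^d with Euclidean norm ‖δ‖₂ < R, it holds that μ{v : F(x + δ + v) = k} > 1/2; in particular, for every class j ≠ k, μ{v : F(x + δ + v) = j} < μ{v : F(x + δ + v) = k}, so the smoothed classifier predicts k at x + δ. -/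
open MeasureTheory ProbabilityTheory
open scoped ENNReal NNReal

lemma aux_half (a : ℝ) (ha : 0 < a) : (1 / 2 : ℝ≥0∞) < gaussianReal 0 1 (Set.Iic a) := by
  have h1 : gaussianReal 0 1 (Set.Ici 0) = gaussianReal 0 1 (Set.Iic (0:ℝ)) := by
    have h := gaussianReal_map_neg (μ := 0) (v := 1)
    rw [neg_zero] at h
    conv_lhs => rw [← h]
    rw [Measure.map_apply (by fun_prop) measurableSet_Ici]
    congr 1
    ext x
    simp
  have h2 : (1 : ℝ≥0∞) ≤ gaussianReal 0 1 (Set.Iic (0:ℝ)) + gaussianReal 0 1 (Set.Iic (0:ℝ)) := by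
    calc (1 : ℝ≥0∞) = gaussianReal 0 1 (Set.Iic (0:ℝ) ∪ Set.Ici 0) := by
          rw [Set.Iic_union_Ici]; simp
      _ ≤ _ := (measure_union_le _ _).trans (by rw [h1])
  have h3 : (1 / 2 : ℝ≥0∞) ≤ gaussianReal 0 1 (Set.Iic (0:ℝ)) := by
    rw [← two_mul] at h2
    rw [ENNReal.div_le_iff_le_mul (by simp) (by simp), mul_comm]
    exact h2
  have h4 : gaussianReal 0 1 (Set.Ioc 0 a) ≠ 0 := by
    intro h
    have := gaussianReal_absolutelyContinuous' 0 (one_ne_zero (α := ℝ≥0)) h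
    simp at this
    linarith
  have h5 : gaussianReal 0 1 (Set.Iic a) =
      gaussianReal 0 1 (Set.Iic 0) + gaussianReal 0 1 (Set.Ioc 0 a) := by
    rw [← measure_union _ measurableSet_Ioc, Set.Iic_union_Ioc_eq_Iic ha.le]
    exact Set.Iic_disjoint_Ioc le_rfl
  rw [h5]
  exact h3.trans_lt (ENNReal.lt_add_right (measure_ne_top _ _) h4)

lemma aux_dens1 (s : ℝ≥0) (hs : s ≠ 0) (m : ℝ) :
    (gaussianReal 0 s).map (fun x => m + x) =
      (gaussianReal 0 s).withDensity
        (fun x => ENNReal.ofReal (Real.exp ((m * x - m ^ 2 / 2) / s))) := by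
  rw [gaussianReal_map_const_add, gaussianReal_of_var_ne_zero _ hs,
    gaussianReal_of_var_ne_zero _ hs, ← withDensity_mul _ (by fun_prop) (by fun_prop)]
  congr 1
  ext x
  have hs' : (s : ℝ) ≠ 0 := by exact_mod_cast hs
  simp only [Pi.mul_apply, gaussianPDF, gaussianPDFReal]
  rw [← ENNReal.ofReal_mul (by positivity), mul_assoc (√(2 * Real.pi * s))⁻¹, ← Real.exp_add]
  congr 3
  field_simp
  ring

lemma aux_dens (d : ℕ) (s : ℝ≥0) (hs : s ≠ 0) (δ : Fin d → ℝ) :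
    (Measure.pi fun _ : Fin d => gaussianReal 0 s).map (fun v => δ + v) =
      (Measure.pi fun _ : Fin d => gaussianReal 0 s).withDensity
        (fun v => ENNReal.ofReal (Real.exp ((∑ i, δ i * v i - (∑ i, δ i ^ 2) / 2) / s))) := by
  have e1 : (Measure.pi fun _ : Fin d => gaussianReal 0 s).map (fun v => δ + v) =
      Measure.pi (fun i => (gaussianReal 0 s).map (fun x => δ i + x)) := by
    have : ∀ i, SigmaFinite ((gaussianReal 0 s).map (fun x => δ i + x)) := by
      intro i; rw [gaussianReal_map_const_add]; infer_instance
    rw [← Measure.pi_map_pi (fun i => by fun_prop)]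
    rfl
  rw [e1]
  have : ∀ i, SigmaFinite ((gaussianReal 0 s).map (fun x => δ i + x)) := by
    intro i; rw [gaussianReal_map_const_add]; infer_instance
  refine Measure.pi_eq fun S hS => ?_
  set ρ : Fin d → ℝ → ℝ≥0∞ := fun i x =>
    ENNReal.ofReal (Real.exp ((δ i * x - δ i ^ 2 / 2) / s)) with hρ
  have hρm : ∀ i, Measurable (ρ i) := fun i => by simp only [hρ]; fun_prop
  have hSm : MeasurableSet (Set.univ.pi S) := MeasurableSet.univ_pi hS
  have hind : iIndepFun (fun i (v : Fin d → ℝ) => (S i).indicator (ρ i) (v i))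
      (Measure.pi fun _ : Fin d => gaussianReal 0 s) :=
    iIndepFun_pi (X := fun i => (S i).indicator (ρ i))
      (fun i => ((hρm i).indicator (hS i)).aemeasurable)
  rw [withDensity_apply _ hSm, ← lintegral_indicator hSm]
  have e2 : ∀ v : Fin d → ℝ, (Set.univ.pi S).indicator
      (fun v => ENNReal.ofReal (Real.exp ((∑ i, δ i * v i - (∑ i, δ i ^ 2) / 2) / s))) v
      = ∏ i, (S i).indicator (ρ i) (v i) := by
    intro v
    by_cases hv : v ∈ Set.univ.pi S
    · rw [Set.indicator_of_mem hv]
      have : ∀ i, (S i).indicator (ρ i) (v i) = ρ i (v i) := fun i =>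
        Set.indicator_of_mem (hv i (Set.mem_univ i)) _
      rw [Finset.prod_congr rfl fun i _ => this i]
      simp only [hρ]
      rw [← ENNReal.ofReal_prod_of_nonneg (fun i _ => (Real.exp_pos _).le), ← Real.exp_sum,
        ← Finset.sum_div, Finset.sum_sub_distrib, Finset.sum_div]
    · rw [Set.indicator_of_notMem hv]
      have : ∃ i, v i ∉ S i := by simpa [Set.mem_pi] using hv
      obtain ⟨i, hi⟩ := this
      exact (Finset.prod_eq_zero (Finset.mem_univ i) (Set.indicator_of_notMem hi _)).symm
  simp_rw [e2]
  rw [lintegral_prod_eq_prod_lintegral_of_indepFun Finset.univ _ hind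
    (fun i => ((hρm i).indicator (hS i)).comp (measurable_pi_apply i))]
  refine Finset.prod_congr rfl fun i _ => ?_
  rw [aux_dens1 s hs, withDensity_apply _ (hS i), ← lintegral_indicator (hS i)]
  exact (measurePreserving_eval (fun _ : Fin d => gaussianReal 0 s) i).lintegral_comp
    ((hρm i).indicator (hS i))

lemma aux_law (d : ℕ) (s : ℝ≥0) (δ : Fin d → ℝ) :
    (Measure.pi fun _ : Fin d => gaussianReal 0 s).map (fun v => ∑ i, δ i * v i) =
      gaussianReal 0 (s * ∑ i, NNReal.mk (δ i ^ 2) (sq_nonneg _)) := by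
  have : IsProbabilityMeasure
      ((Measure.pi fun _ : Fin d => gaussianReal 0 s).map (fun v => ∑ i, δ i * v i)) :=
    Measure.isProbabilityMeasure_map (Measurable.aemeasurable (by fun_prop))
  apply Measure.ext_of_charFun
  ext t
  rw [charFun_gaussianReal, charFun_apply_real, integral_map
    (Measurable.aemeasurable (by fun_prop)) (Measurable.aestronglyMeasurable (by fun_prop))]
  have e : ∀ v : Fin d → ℝ, Complex.exp (t * ((∑ i, δ i * v i : ℝ) : ℂ) * Complex.I) =
      ∏ i, (fun i (x : ℝ) => Complex.exp (((t * δ i : ℝ) : ℂ) * x * Complex.I)) i (v i) := by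
    intro v
    rw [← Complex.exp_sum]
    congr 1
    push_cast
    rw [Finset.mul_sum, Finset.sum_mul]
    refine Finset.sum_congr rfl fun i _ => by ring
  simp_rw [e]
  rw [integral_fintype_prod_eq_prod
    (f := fun i (x : ℝ) => Complex.exp (((t * δ i : ℝ) : ℂ) * x * Complex.I))]
  simp_rw [← charFun_apply_real, charFun_gaussianReal]
  rw [← Complex.exp_sum]
  congr 1
  simp only [NNReal.coe_mul, NNReal.coe_sum, NNReal.coe_mk]
  push_cast
  simp only [mul_zero, zero_mul, zero_sub, Finset.mul_sum, Finset.sum_mul, Finset.sum_div,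
    Finset.sum_neg_distrib]
  congr 1
  refine Finset.sum_congr rfl fun i _ => ?_
  ring

lemma aux_halfspace (d : ℕ) (σ : ℝ) (hσ : 0 < σ) (s : ℝ≥0)
    (hs : (s : ℝ) = σ ^ 2) (δ : Fin d → ℝ) (n : ℝ) (hn : 0 < n)
    (hnd : n ^ 2 = ∑ i, δ i ^ 2) (a : ℝ) :
    (Measure.pi fun _ : Fin d => gaussianReal 0 s)
      {v | ∑ i, δ i * v i ≤ n * a} = gaussianReal 0 1 (Set.Iic (a / σ)) := by
  have h1 := aux_law d s δ
  have h2 := gaussianReal_map_const_mul (μ := 0) (v := 1) (n * σ)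
  have h3 : (NNReal.mk ((n * σ) ^ 2) (sq_nonneg _) * 1 : ℝ≥0) =
      s * ∑ i, NNReal.mk (δ i ^ 2) (sq_nonneg _) := by
    apply NNReal.eq
    push_cast
    rw [← hnd, hs]; ring
  rw [mul_zero, h3, ← h1] at h2
  have h4 : {v : Fin d → ℝ | ∑ i, δ i * v i ≤ n * a} =
    (fun v : Fin d → ℝ => ∑ i, δ i * v i) ⁻¹' Set.Iic (n * a) := rfl
  rw [h4, ← Measure.map_apply (by fun_prop) measurableSet_Iic, ← h2,
    Measure.map_apply (by fun_prop) measurableSet_Iic]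
  congr 1
  ext x
  simp only [Set.mem_preimage, Set.mem_Iic]
  rw [le_div_iff₀ hσ, mul_assoc, mul_le_mul_iff_right₀ hn, mul_comm]

/-- Neyman-Pearson. -/
lemma aux_np {Ω : Type*} [MeasurableSpace Ω] (μ : Measure Ω) [IsFiniteMeasure μ]
    (ρ : Ω → ℝ≥0∞) (c : ℝ≥0∞) (A H : Set Ω) (hA : MeasurableSet A)
    (hH : MeasurableSet H) (h1 : ∀ v ∈ H, ρ v ≤ c) (h2 : ∀ v, v ∉ H → c ≤ ρ v)
    (hle : μ H ≤ μ A) : μ.withDensity ρ H ≤ μ.withDensity ρ A := by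
  rw [← measure_inter_add_sdiff H hA, ← measure_inter_add_sdiff A hH, Set.inter_comm A H]
  rw [← measure_inter_add_sdiff H hA, ← measure_inter_add_sdiff A hH, Set.inter_comm A H] at hle
  have hle' : μ (H \ A) ≤ μ (A \ H) := (ENNReal.add_le_add_iff_left (measure_ne_top _ _)).1 hle
  gcongr _ + ?_
  rw [withDensity_apply _ (hH.diff hA), withDensity_apply _ (hA.diff hH)]
  calc ∫⁻ v in H \ A, ρ v ∂μ ≤ ∫⁻ v in H \ A, c ∂μ :=
        setLIntegral_mono' (hH.diff hA) fun v hv => h1 v hv.1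
    _ = c * μ (H \ A) := setLIntegral_const _ _
    _ ≤ c * μ (A \ H) := by gcongr
    _ = ∫⁻ v in A \ H, c ∂μ := (setLIntegral_const _ _).symm
    _ ≤ _ := setLIntegral_mono' (hA.diff hH) fun v hv => h2 v hv.2

/-- Randomized smoothing certificate: if under Gaussian noise `N(0, σ²·I_d)`
the base classifier `F` predicts class `k` at `x` with probability at least
`Φ(R/σ)`, then for every perturbation `δ` with `‖δ‖₂ < R` the smoothed
classifier still predicts `k` at `x + δ`: class `k` has probability `> 1/2`,
hence strictly larger probability than any other class. -/
theorem stmt_14 (d c : ℕ) (hd : 1 ≤ d) (hc : 1 ≤ c)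
    (σ R : ℝ) (hσ : 0 < σ) (hR : 0 < R)
    (F : (Fin d → ℝ) → Fin c) (hF : Measurable F)
    (μ : Measure (Fin d → ℝ))
    (hμ : μ = Measure.pi fun _ : Fin d => gaussianReal 0 ⟨σ ^ 2, sq_nonneg σ⟩)
    (x : Fin d → ℝ) (k : Fin c)
    (hk : ENNReal.ofReal (cdf (gaussianReal 0 1) (R / σ)) ≤
      μ {v | F (x + v) = k}) :
    ∀ δ : Fin d → ℝ, Real.sqrt (∑ i, δ i ^ 2) < R →
      (1 / 2 : ℝ≥0∞) < μ {v | F (x + δ + v) = k} ∧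
      ∀ j : Fin c, j ≠ k →
        μ {v | F (x + δ + v) = j} < μ {v | F (x + δ + v) = k} := by
  intro δ hδ
  obtain ⟨s, hs, hμ⟩ : ∃ s : ℝ≥0, (s : ℝ) = σ ^ 2 ∧
      μ = Measure.pi fun _ : Fin d => gaussianReal 0 s :=
    ⟨NNReal.mk (σ ^ 2) (sq_nonneg σ), rfl, hμ⟩
  have : IsProbabilityMeasure μ := by rw [hμ]; infer_instance
  have hmeas : ∀ (y : Fin d → ℝ) (j : Fin c), MeasurableSet {v | F (y + v) = j} := fun y j =>
    (hF.comp (measurable_const_add y)) (measurableSet_singleton j)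
  have key : (1 / 2 : ℝ≥0∞) < μ {v | F (x + δ + v) = k} := by
    have hk' : gaussianReal 0 1 (Set.Iic (R / σ)) ≤ μ {v | F (x + v) = k} := by
      rwa [ofReal_cdf] at hk
    set n := Real.sqrt (∑ i, δ i ^ 2) with hn
    have hn2 : n ^ 2 = ∑ i, δ i ^ 2 :=
      Real.sq_sqrt (Finset.sum_nonneg fun i _ => sq_nonneg _)
    rcases (Real.sqrt_nonneg (∑ i, δ i ^ 2)).eq_or_lt with h0 | h0
    · have hz : δ = 0 := by
        rw [← hn] at h0
        rw [← h0] at hn2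
        have := (Finset.sum_eq_zero_iff_of_nonneg
          (fun i (_ : i ∈ Finset.univ) => sq_nonneg (δ i))).1 (by rw [← hn2]; norm_num)
        ext i
        simpa using this i (Finset.mem_univ i)
      rw [hz, add_zero]
      exact (aux_half _ (by positivity)).trans_le hk'
    · rw [← hn] at h0
      have hsp : (0 : ℝ) < s := by rw [hs]; positivity
      have hs0 : s ≠ 0 := by
        rintro rfl
        simp at hsp
      have hd := aux_dens d s hs0 δ
      rw [← hμ] at hd
      have hH : MeasurableSet {v : Fin d → ℝ | ∑ i, δ i * v i ≤ n * R} :=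
        measurableSet_le (by fun_prop) (by fun_prop)
      have np := aux_np μ
        (fun v => ENNReal.ofReal (Real.exp ((∑ i, δ i * v i - (∑ i, δ i ^ 2) / 2) /
          (s : ℝ))))
        (ENNReal.ofReal (Real.exp ((n * R - (∑ i, δ i ^ 2) / 2) /
          (s : ℝ))))
        {v | F (x + v) = k} {v | ∑ i, δ i * v i ≤ n * R} (hmeas x k) hH
        (fun v hv => by
          have hv' : ∑ i, δ i * v i ≤ n * R := hv
          gcongr)
        (fun v hv => by
          have hv' : n * R ≤ ∑ i, δ i * v i := (not_le.1 hv).le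
          gcongr)
        (by
          have := aux_halfspace d σ hσ s hs δ n h0 hn2 R
          rw [← hμ] at this
          rw [this]; exact hk')
      rw [← hd, Measure.map_apply (by fun_prop) hH,
        Measure.map_apply (by fun_prop) (hmeas x k)] at np
      have e1 : (fun v => δ + v) ⁻¹' {v : Fin d → ℝ | F (x + v) = k} =
          {v | F (x + δ + v) = k} := by
        ext v; simp [add_assoc]
      have e2 : (fun v => δ + v) ⁻¹' {v : Fin d → ℝ | ∑ i, δ i * v i ≤ n * R} =
          {v | ∑ i, δ i * v i ≤ n * (R - n)} := by
        ext v
        simp only [Set.mem_preimage, Set.mem_setOf_eq, Pi.add_apply, mul_add,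
          Finset.sum_add_distrib]
        have : ∑ i, δ i * δ i = n ^ 2 := by rw [hn2]; simp [sq]
        rw [this]
        constructor <;> intro h <;> nlinarith
      have e3 := aux_halfspace d σ hσ s hs δ n h0 hn2 (R - n)
      rw [← hμ] at e3
      rw [e1, e2, e3] at np
      exact (aux_half _ (div_pos (sub_pos.2 hδ) hσ)).trans_le np
  refine ⟨key, fun j hj => ?_⟩
  by_contra hcon
  have hj2 := key.trans_le (not_lt.1 hcon)
  have hdis : Disjoint {v | F (x + δ + v) = j} {v | F (x + δ + v) = k} := by
    rw [Set.disjoint_left]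
    intro v hv hv'
    exact hj (hv.symm.trans hv')
  have hun := measure_union (μ := μ) hdis (hmeas (x + δ) k)
  have hlt := ENNReal.add_lt_add hj2 key
  rw [← hun, ENNReal.add_halves] at hlt
  exact absurd prob_le_one (not_le.2 hlt)
end

section
/- Let d ≥ 1 and c ≥ 1 be natural numbers, let Σ be a symmetric positive definite real d×d covariance matrix, R > 0 a real number, F : ℝ^d → Fin c a measurable function, and let μ be the multivariate Gaussian measure N(0, Σ) on ℝ^d. Fix x ∈ ℝ^d and a class k ∈ Fin c, and suppose μ{v : F(x + v) = k} ≥ Φ(R), where Φ is the standard normal cumulative distribution function. Then for every δ ∈ ℝ^d with δᵀ Σ⁻¹ δ < R² (equivalently ‖δ‖_{Σ⁻¹} < R), it holds that μ{v : F(x + δ + v) = k} > 1/2; in particular the smoothed classifier predicts k at x + δ. -/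
open MeasureTheory ProbabilityTheory Matrix
open scoped ENNReal

/-- The multivariate Gaussian measure `N(0, S)` on `ℝ^d`, for a (positive
definite) covariance matrix `S`, given by its density
`(2π)^{−d/2} (det S)^{−1/2} exp(−xᵀ S⁻¹ x / 2)` w.r.t. Lebesgue measure. -/
noncomputable def multivariateGaussian {d : ℕ} (S : Matrix (Fin d) (Fin d) ℝ) :
    Measure (Fin d → ℝ) :=
  volume.withDensity fun x => ENNReal.ofReal
    (Real.sqrt (((2 * Real.pi) ^ d * S.det)⁻¹) * Real.exp (-(x ⬝ᵥ S⁻¹ *ᵥ x) / 2))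

namespace SmoothAux

noncomputable def P {d : ℕ} (w : Fin d → ℝ) : ℝ≥0∞ :=
  ENNReal.ofReal (((Real.sqrt (2 * Real.pi)) ^ d)⁻¹ * Real.exp (-(w ⬝ᵥ w) / 2))

lemma prod_pdf {d : ℕ} (w : Fin d → ℝ) :
    ∏ i, gaussianPDFReal 0 1 (w i)
      = ((Real.sqrt (2 * Real.pi)) ^ d)⁻¹ * Real.exp (-(w ⬝ᵥ w) / 2) := by
  simp only [gaussianPDFReal, Finset.prod_mul_distrib, ← Real.exp_sum, dotProduct]
  simp [Finset.sum_div, neg_div, ← sq]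
  rw [← mul_inv, inv_pow, mul_comm]

lemma measurable_P {d : ℕ} : Measurable (P (d := d)) := by
  unfold P
  simp only [dotProduct]
  fun_prop

lemma pi_eq (d : ℕ) :
    Measure.pi (fun _ : Fin d => gaussianReal 0 1) = volume.withDensity (P (d := d)) := by
  refine Measure.pi_eq ?_
  intro s hs
  rw [withDensity_apply _ (MeasurableSet.univ_pi hs), volume_pi, Measure.restrict_pi_pi]
  have hP : ∀ w : Fin d → ℝ, P w = ENNReal.ofReal (∏ i, gaussianPDFReal 0 1 (w i)) := by
    intro w; rw [prod_pdf]; rfl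
  simp_rw [hP]
  have hint : ∀ i, Integrable (gaussianPDFReal 0 1) ((volume : Measure ℝ).restrict (s i)) :=
    fun i => (integrable_gaussianPDFReal 0 1).restrict
  rw [← ofReal_integral_eq_lintegral_ofReal]
  · rw [integral_fintype_prod_eq_prod (fun _ : Fin d => gaussianPDFReal 0 1),
      ENNReal.ofReal_prod_of_nonneg]
    · refine Finset.prod_congr rfl fun i _ => ?_
      rw [gaussianReal_apply_eq_integral 0 one_ne_zero]
    · intro i _
      exact integral_nonneg fun _ => gaussianPDFReal_nonneg _ _ _
  · exact Integrable.fintype_prod (f := fun _ : Fin d => gaussianPDFReal 0 1) hint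
  · exact Filter.Eventually.of_forall fun w =>
      Finset.prod_nonneg fun i _ => gaussianPDFReal_nonneg _ _ _

open scoped MatrixOrder in
lemma exists_factor {d : ℕ} {S : Matrix (Fin d) (Fin d) ℝ} (hS : S.PosDef) :
    ∃ A : Matrix (Fin d) (Fin d) ℝ, S = A * Aᵀ := by
  obtain ⟨y, hy⟩ := CStarAlgebra.nonneg_iff_eq_star_mul_self.mp hS.posSemidef.nonneg
  refine ⟨yᵀ, ?_⟩
  rw [hy, Matrix.transpose_transpose, Matrix.star_eq_conjTranspose,
    Matrix.conjTranspose_eq_transpose_of_trivial]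

noncomputable def dens {d : ℕ} (S : Matrix (Fin d) (Fin d) ℝ) (x : Fin d → ℝ) : ℝ≥0∞ :=
  ENNReal.ofReal
    (Real.sqrt (((2 * Real.pi) ^ d * S.det)⁻¹) * Real.exp (-(x ⬝ᵥ S⁻¹ *ᵥ x) / 2))

lemma measurable_dens {d : ℕ} (S : Matrix (Fin d) (Fin d) ℝ) : Measurable (dens S) := by
  unfold dens
  simp only [dotProduct, mulVec]
  fun_prop

lemma gauss_eq_map {d : ℕ} {S A : Matrix (Fin d) (Fin d) ℝ} (hA : S = A * Aᵀ)
    (hdet : A.det ≠ 0) :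
    volume.withDensity (dens S) =
      (Measure.pi (fun _ : Fin d => gaussianReal 0 1)).map (toLin' A) := by
  have hm : Measurable (toLin' A) := (toLin' A).continuous_of_finiteDimensional.measurable
  have hu : IsUnit A.det := isUnit_iff_ne_zero.2 hdet
  have huT : IsUnit Aᵀ.det := by rwa [det_transpose]
  ext s hs
  rw [Measure.map_apply hm hs, pi_eq, withDensity_apply _ hs, withDensity_apply _ (hm hs)]
  have hvol : (volume : Measure (Fin d → ℝ)) =
      ENNReal.ofReal |A.det| • Measure.map (toLin' A) volume := by
    rw [Real.map_matrix_volume_pi_eq_smul_volume_pi hdet, smul_smul,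
      ← ENNReal.ofReal_mul (abs_nonneg _), ← abs_mul, mul_inv_cancel₀ hdet]
    simp
  conv_lhs => rw [hvol]
  rw [Measure.restrict_smul, lintegral_smul_measure, setLIntegral_map hs (measurable_dens S) hm,
    smul_eq_mul, ← lintegral_const_mul (f := fun w => dens S (toLin' A w)) _
      ((measurable_dens S).comp hm)]
  refine lintegral_congr fun w => ?_
  simp only [dens, P]
  rw [← ENNReal.ofReal_mul (abs_nonneg _)]
  have e1 : (toLin' A w) ⬝ᵥ S⁻¹ *ᵥ (toLin' A w) = w ⬝ᵥ w := by
    rw [toLin'_apply, hA, Matrix.mul_inv_rev, ← Matrix.mulVec_mulVec,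
      Matrix.mulVec_mulVec _ A⁻¹ A, Matrix.nonsing_inv_mul _ hu, Matrix.one_mulVec,
      ← Matrix.vecMul_transpose A, ← Matrix.dotProduct_mulVec,
      Matrix.mulVec_mulVec, Matrix.mul_nonsing_inv _ huT, Matrix.one_mulVec]
  have e2 : |A.det| * Real.sqrt (((2 * Real.pi) ^ d * S.det)⁻¹)
      = ((Real.sqrt (2 * Real.pi)) ^ d)⁻¹ := by
    have : S.det = |A.det| ^ 2 := by rw [hA, det_mul, det_transpose, sq_abs, sq]
    rw [this, Real.sqrt_inv, Real.sqrt_mul (by positivity), Real.sqrt_sq (abs_nonneg _)]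
    have h3 : Real.sqrt ((2 * Real.pi) ^ d) = Real.sqrt (2 * Real.pi) ^ d := by
      rw [Real.sqrt_eq_iff_mul_self_eq (by positivity) (by positivity), ← mul_pow,
        Real.mul_self_sqrt (by positivity)]
    rw [h3]
    have : |A.det| ≠ 0 := abs_ne_zero.2 hdet
    field_simp
  rw [e1, ← mul_assoc, e2]

lemma law_std {d : ℕ} (η : Fin d → ℝ) :
    (Measure.pi (fun _ : Fin d => gaussianReal 0 1)).map (fun w => η ⬝ᵥ w)
      = gaussianReal 0 (η ⬝ᵥ η).toNNReal := by
  have h1 : (fun w : Fin d → ℝ => η ⬝ᵥ w) =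
      (innerSL ℝ (WithLp.toLp 2 η : EuclideanSpace ℝ (Fin d))) ∘ (WithLp.toLp 2) := by
    ext w
    simp [PiLp.inner_apply, dotProduct, mul_comm]
  rw [h1, ← Measure.map_map (by fun_prop) (by fun_prop), map_pi_eq_stdGaussian,
    IsGaussian.map_eq_gaussianReal, integral_strongDual_stdGaussian, variance_dual_stdGaussian]
  congr 2
  rw [innerSL_apply_norm, EuclideanSpace.real_norm_sq_eq]
  simp [dotProduct, sq]

lemma half_lt {t : ℝ} (ht : 0 < t) : (1 / 2 : ℝ≥0∞) < gaussianReal 0 1 (Set.Iic t) := by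
  set γ := gaussianReal 0 1
  have h1 : γ (Set.Iio (-t)) = γ (Set.Ioi t) := by
    have : γ.map (fun x => -x) = γ := by simp [γ, gaussianReal_map_neg]
    conv_lhs => rw [← this]
    rw [Measure.map_apply measurable_neg measurableSet_Iio]
    congr 1
    ext x; simp
  have h2 : γ (Set.Iic t) + γ (Set.Ioi t) = 1 := by
    rw [← Set.compl_Iic]; exact prob_add_prob_compl measurableSet_Iic
  have h3 : γ (Set.Iic t) = γ (Set.Iio (-t)) + γ (Set.Icc (-t) t) := by
    rw [← measure_union _ measurableSet_Icc]
    · congr 1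
      ext x
      simp only [Set.mem_Iic, Set.mem_union, Set.mem_Iio, Set.mem_Icc]
      grind
    · rw [Set.disjoint_left]; intro x hx hx'
      simp at hx hx'; linarith
  have h4 : γ (Set.Icc (-t) t) ≠ 0 := by
    intro h0
    have := gaussianReal_absolutelyContinuous' 0 (v := 1) one_ne_zero h0
    rw [Real.volume_Icc, ENNReal.ofReal_eq_zero] at this
    linarith
  have h5 : γ (Set.Ioi t) < γ (Set.Iic t) := by
    rw [h3, h1]
    exact ENNReal.lt_add_right (measure_ne_top _ _) h4
  by_contra! hle
  have : γ (Set.Iic t) + γ (Set.Ioi t) < 1 / 2 + 1 / 2 :=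
    ENNReal.add_lt_add_of_le_of_lt (measure_ne_top _ _) hle (h5.trans_le hle)
  rw [h2, ENNReal.add_halves] at this
  exact lt_irrefl _ this

lemma scale {s : ℝ} (hs : 0 < s) (t : ℝ) :
    gaussianReal 0 (s ^ 2).toNNReal (Set.Iic (s * t)) = gaussianReal 0 1 (Set.Iic t) := by
  have h := gaussianReal_map_const_mul (μ := 0) (v := 1) s
  have h2 : (gaussianReal 0 1).map (s * ·) = gaussianReal 0 (s ^ 2).toNNReal := by
    rw [h, mul_zero, mul_one]
    congr 1
    ext
    simp [Real.coe_toNNReal _ (sq_nonneg s)]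
  rw [← h2, Measure.map_apply (by fun_prop) measurableSet_Iic]
  congr 1
  ext x
  simp only [Set.mem_preimage, Set.mem_Iic]
  exact mul_le_mul_iff_right₀ hs

lemma neyman_pearson {Ω : Type*} [MeasurableSpace Ω] (μ : Measure Ω) [IsFiniteMeasure μ]
    (ρ : Ω → ℝ≥0∞) (c : ℝ≥0∞) {H B : Set Ω} (hH : MeasurableSet H) (hB : MeasurableSet B)
    (h1 : ∀ v ∈ H, ρ v ≤ c) (h2 : ∀ v ∉ H, c ≤ ρ v) (hle : μ H ≤ μ B) :
    μ.withDensity ρ H ≤ μ.withDensity ρ B := by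
  rw [← measure_inter_add_sdiff H hB, ← measure_inter_add_sdiff B hH, Set.inter_comm B H]
  refine add_le_add le_rfl ?_
  have hd : μ (H \ B) ≤ μ (B \ H) := by
    rw [← measure_inter_add_sdiff H hB, ← measure_inter_add_sdiff B hH, Set.inter_comm B H] at hle
    exact (ENNReal.add_le_add_iff_left (measure_ne_top _ _)).1 hle
  calc μ.withDensity ρ (H \ B) = ∫⁻ v in H \ B, ρ v ∂μ := withDensity_apply _ (hH.diff hB)
    _ ≤ ∫⁻ v in H \ B, c ∂μ := setLIntegral_mono measurable_const fun v hv => h1 v hv.1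
    _ = c * μ (H \ B) := by simp
    _ ≤ c * μ (B \ H) := by gcongr
    _ = ∫⁻ v in B \ H, c ∂μ := by simp
    _ ≤ ∫⁻ v in B \ H, ρ v ∂μ := setLIntegral_mono' (hB.diff hH) fun v hv => h2 v hv.2
    _ = μ.withDensity ρ (B \ H) := (withDensity_apply _ (hB.diff hH)).symm

lemma shift {d : ℕ} {S : Matrix (Fin d) (Fin d) ℝ} (hS : S.PosDef) (δ : Fin d → ℝ) :
    (volume.withDensity (dens S)).map (fun v => δ + v) =
      (volume.withDensity (dens S)).withDensity (fun v => ENNReal.ofReal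
        (Real.exp ((S⁻¹ *ᵥ δ) ⬝ᵥ v - (δ ⬝ᵥ S⁻¹ *ᵥ δ) / 2))) := by
  have hmρ : Measurable (fun v : Fin d → ℝ => ENNReal.ofReal
        (Real.exp ((S⁻¹ *ᵥ δ) ⬝ᵥ v - (δ ⬝ᵥ S⁻¹ *ᵥ δ) / 2))) := by
    simp only [dotProduct]
    fun_prop
  have hm : Measurable (fun v : Fin d → ℝ => δ + v) := by fun_prop
  have hsymm : (S⁻¹)ᵀ = S⁻¹ := by
    have := hS.inv.isHermitian.eq
    rwa [Matrix.conjTranspose_eq_transpose_of_trivial] at this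
  have hcomm : ∀ v, v ⬝ᵥ S⁻¹ *ᵥ δ = δ ⬝ᵥ S⁻¹ *ᵥ v := by
    intro v
    rw [Matrix.dotProduct_mulVec, ← Matrix.mulVec_transpose, hsymm, dotProduct_comm]
  rw [← withDensity_mul _ (measurable_dens S) hmρ]
  ext s hs
  rw [Measure.map_apply hm hs, withDensity_apply _ hs, withDensity_apply _ (hm hs)]
  have hvol : Measure.map (fun v : Fin d → ℝ => δ + v) volume = volume :=
    map_add_left_eq_self volume δ
  conv_rhs => rw [← hvol]
  rw [setLIntegral_map hs ((measurable_dens S).mul hmρ) hm]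
  refine lintegral_congr fun v => ?_
  simp only [dens, Pi.mul_apply]
  rw [← ENNReal.ofReal_mul (by positivity), mul_assoc, ← Real.exp_add]
  congr 3
  simp only [Matrix.mulVec_add, dotProduct_add, add_dotProduct, dotProduct_comm (S⁻¹ *ᵥ δ), hcomm]
  ring

lemma law {d : ℕ} {S : Matrix (Fin d) (Fin d) ℝ} (hS : S.PosDef) (δ : Fin d → ℝ) :
    IsProbabilityMeasure (volume.withDensity (dens S)) ∧
    (volume.withDensity (dens S)).map (fun v => (S⁻¹ *ᵥ δ) ⬝ᵥ v) =
      gaussianReal 0 (δ ⬝ᵥ S⁻¹ *ᵥ δ).toNNReal := by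
  obtain ⟨A, hA⟩ := exists_factor hS
  have hSd : S.det ≠ 0 := hS.det_pos.ne'
  have hdet : A.det ≠ 0 := by
    intro h
    apply hSd
    rw [hA, det_mul, h, zero_mul]
  have hm : Measurable (toLin' A) := (toLin' A).continuous_of_finiteDimensional.measurable
  have hl : ∀ a : Fin d → ℝ, Measurable (fun v : Fin d → ℝ => a ⬝ᵥ v) := by
    intro a
    simp only [dotProduct]
    fun_prop
  rw [gauss_eq_map hA hdet]
  refine ⟨Measure.isProbabilityMeasure_map hm.aemeasurable, ?_⟩
  rw [Measure.map_map (hl _) hm]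
  have : (fun v : Fin d → ℝ => (S⁻¹ *ᵥ δ) ⬝ᵥ v) ∘ (toLin' A)
      = fun w => (Aᵀ *ᵥ (S⁻¹ *ᵥ δ)) ⬝ᵥ w := by
    ext w
    simp only [Function.comp, toLin'_apply]
    rw [Matrix.dotProduct_mulVec, Matrix.mulVec_transpose]
  rw [this, law_std]
  congr 2
  rw [Matrix.dotProduct_mulVec, Matrix.vecMul_transpose, Matrix.mulVec_mulVec, ← hA,
    Matrix.mulVec_mulVec, Matrix.mul_nonsing_inv _ (isUnit_iff_ne_zero.2 hSd), Matrix.one_mulVec]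

lemma main {d : ℕ} {S : Matrix (Fin d) (Fin d) ℝ} (hS : S.PosDef) {R : ℝ} (hR : 0 < R)
    {B : Set (Fin d → ℝ)} (hB : MeasurableSet B)
    (hk : gaussianReal 0 1 (Set.Iic R) ≤ volume.withDensity (dens S) B)
    (δ : Fin d → ℝ) (hδ : δ ⬝ᵥ S⁻¹ *ᵥ δ < R ^ 2) :
    (1 / 2 : ℝ≥0∞) < volume.withDensity (dens S) ((fun v => δ + v) ⁻¹' B) := by
  by_cases h0 : δ = 0
  · subst h0
    simpa using (half_lt hR).trans_le hk
  obtain ⟨hprob, hlaw⟩ := law hS δ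
  have hsh := shift hS δ
  have hq : 0 < δ ⬝ᵥ S⁻¹ *ᵥ δ := by
    simpa using hS.inv.dotProduct_mulVec_pos h0
  set q := δ ⬝ᵥ S⁻¹ *ᵥ δ with hqdef
  set μ := volume.withDensity (dens S)
  set s := Real.sqrt q
  have hs : 0 < s := Real.sqrt_pos.2 hq
  have hsq : s ^ 2 = q := Real.sq_sqrt hq.le
  have hsR : s < R := by
    nlinarith
  have hl : Measurable (fun v : Fin d → ℝ => (S⁻¹ *ᵥ δ) ⬝ᵥ v) := by
    simp only [dotProduct]
    fun_prop
  have hm : Measurable (fun v : Fin d → ℝ => δ + v) := by fun_prop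
  let H : Set (Fin d → ℝ) := (fun v => (S⁻¹ *ᵥ δ) ⬝ᵥ v) ⁻¹' Set.Iic (s * R)
  have hH : MeasurableSet H := hl measurableSet_Iic
  have hμ : ∀ t, μ ((fun v => (S⁻¹ *ᵥ δ) ⬝ᵥ v) ⁻¹' Set.Iic (s * t))
      = gaussianReal 0 1 (Set.Iic t) := by
    intro t
    rw [← Measure.map_apply hl measurableSet_Iic, hlaw, ← hsq, scale hs]
  have hNP := neyman_pearson μ (fun v => ENNReal.ofReal
        (Real.exp ((S⁻¹ *ᵥ δ) ⬝ᵥ v - q / 2))) (ENNReal.ofReal (Real.exp (s * R - q / 2)))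
        hH hB ?_ ?_ ((hμ R).trans_le hk)
  · rw [← hsh, Measure.map_apply hm hH, Measure.map_apply hm hB] at hNP
    refine lt_of_lt_of_le ?_ hNP
    have : (fun v => δ + v) ⁻¹' H = (fun v => (S⁻¹ *ᵥ δ) ⬝ᵥ v) ⁻¹' Set.Iic (s * (R - s)) := by
      ext v
      simp only [H, Set.mem_preimage, Set.mem_Iic, dotProduct_add]
      rw [dotProduct_comm _ δ, ← hqdef, ← hsq]
      constructor <;> intro h <;> linarith
    rw [this, hμ]
    exact half_lt (by linarith)
  · intro v hv
    have hv' : (S⁻¹ *ᵥ δ) ⬝ᵥ v ≤ s * R := hv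
    gcongr
  · intro v hv
    have hv' : s * R < (S⁻¹ *ᵥ δ) ⬝ᵥ v := not_le.1 hv
    gcongr

end SmoothAux

/-- Mahalanobis randomized smoothing certificate: if under anisotropic Gaussian
noise `N(0, Σ)` the base classifier `F` predicts class `k` at `x` with
probability at least `Φ(R)`, then for every `δ` with `δᵀ Σ⁻¹ δ < R²`
(i.e. `‖δ‖_{Σ⁻¹} < R`), class `k` has probability `> 1/2` at `x + δ`, so the
smoothed classifier predicts `k` at `x + δ`. -/
theorem stmt_15 (d c : ℕ) (hd : 1 ≤ d) (hc : 1 ≤ c)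
    (S : Matrix (Fin d) (Fin d) ℝ) (hS : S.PosDef)
    (R : ℝ) (hR : 0 < R)
    (F : (Fin d → ℝ) → Fin c) (hF : Measurable F)
    (μ : Measure (Fin d → ℝ)) (hμ : μ = multivariateGaussian S)
    (x : Fin d → ℝ) (k : Fin c)
    (hk : ENNReal.ofReal (cdf (gaussianReal 0 1) R) ≤ μ {v | F (x + v) = k}) :
    ∀ δ : Fin d → ℝ, δ ⬝ᵥ S⁻¹ *ᵥ δ < R ^ 2 →
      (1 / 2 : ℝ≥0∞) < μ {v | F (x + δ + v) = k} ∧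
      ∀ j : Fin c, j ≠ k →
        μ {v | F (x + δ + v) = j} < μ {v | F (x + δ + v) = k} := by
  intro δ hδ
  have hμ' : μ = volume.withDensity (SmoothAux.dens S) := hμ
  have hprob : IsProbabilityMeasure μ := by
    rw [hμ']; exact (SmoothAux.law hS δ).1
  have hmeas : ∀ (y : Fin d → ℝ) (j : Fin c), MeasurableSet {v | F (y + v) = j} := by
    intro y j
    exact (hF.comp (measurable_const_add y)) (measurableSet_singleton j)
  have hmain : (1 / 2 : ℝ≥0∞) < μ {v | F (x + δ + v) = k} := by
    have hset : {v | F (x + δ + v) = k} = (fun v => δ + v) ⁻¹' {v | F (x + v) = k} := by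
      ext v
      simp [add_assoc]
    rw [hset, hμ']
    refine SmoothAux.main hS hR (hmeas x k) ?_ δ hδ
    rw [← hμ', ← ofReal_cdf]
    exact hk
  refine ⟨hmain, fun j hj => ?_⟩
  by_contra! hle
  have hdisj : Disjoint {v | F (x + δ + v) = j} {v | F (x + δ + v) = k} := by
    rw [Set.disjoint_left]
    intro v hv hv'
    exact hj (hv.symm.trans hv')
  have h1 : μ {v | F (x + δ + v) = j} + μ {v | F (x + δ + v) = k} ≤ 1 := by
    rw [← measure_union hdisj (hmeas _ _)]
    exact prob_le_one
  have h2 : (1 / 2 : ℝ≥0∞) + 1 / 2 <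
      μ {v | F (x + δ + v) = j} + μ {v | F (x + δ + v) = k} :=
    ENNReal.add_lt_add (hmain.trans_le hle) hmain
  rw [ENNReal.add_halves] at h2
  exact absurd h1 (not_le.2 h2)
end

section
/- Let d ≥ 1 and c ≥ 1 be natural numbers, η > 0 and τ ∈ (1/2, 1] real numbers, F : ℝ^d → Fin c a measurable function, and let μ be the uniform probability measure on the cube [−η, η]^d (the d-fold product of the uniform distribution on [−η, η]). Fix x ∈ ℝ^d and a class k ∈ Fin c, and suppose μ{v : F(x + v) = k} ≥ τ. Then for every δ ∈ ℝ^d with ℓ₁ norm ‖δ‖₁ < 2η(τ − 1/2), it holds that μ{v : F(x + δ + v) = k} > 1/2; in particular the smoothed classifier predicts k at x + δ, yielding an ℓ₁ robustness certificate of radius R = 2η(τ − 0.5). -/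
open MeasureTheory
open scoped ENNReal

/-- The uniform distribution on `[-η, η]`. -/
noncomputable def unif (η : ℝ) : Measure ℝ :=
  (ENNReal.ofReal (2 * η))⁻¹ • volume.restrict (Set.Icc (-η) η)

theorem unif_prob {η : ℝ} (hη : 0 < η) : IsProbabilityMeasure (unif η) := by
  constructor
  have h : (0 : ℝ) < 2 * η := by linarith
  simp only [unif, Measure.smul_apply, Measure.restrict_apply_univ, Real.volume_Icc, smul_eq_mul]
  rw [show η - -η = 2 * η by ring]
  exact ENNReal.inv_mul_cancel (by simpa using hη) ENNReal.ofReal_ne_top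

/-- The overlap of the interval and its translate. -/
def ovl (η t : ℝ) : Set ℝ := Set.Icc (-η) η ∩ Set.Icc (t - η) (t + η)

theorem ovl_meas (η t : ℝ) : MeasurableSet (ovl η t) :=
  measurableSet_Icc.inter measurableSet_Icc

theorem unif_compl {η : ℝ} (hη : 0 < η) (t : ℝ) :
    unif η (ovl η t)ᶜ ≤ ENNReal.ofReal (|t| / (2 * η)) := by
  have h : (0 : ℝ) < 2 * η := by linarith
  rw [div_eq_inv_mul, ENNReal.ofReal_mul (by positivity), ENNReal.ofReal_inv_of_pos h]
  simp only [unif, Measure.smul_apply, smul_eq_mul]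
  gcongr
  rw [Measure.restrict_apply (ovl_meas η t).compl]
  have hs : (ovl η t)ᶜ ∩ Set.Icc (-η) η ⊆ Set.Icc (-η) (t - η) ∪ Set.Icc (t + η) η := by
    rintro y ⟨hy, hy2⟩
    by_contra hcon
    apply hy
    simp only [Set.mem_union, Set.mem_Icc, not_or, not_and, not_le] at hcon
    refine ⟨hy2, ?_, ?_⟩
    · exact (hcon.1 hy2.1).le
    · by_contra h3
      have := hcon.2 (not_le.mp h3).le
      linarith [hy2.2]
  refine (measure_mono hs).trans ((measure_union_le _ _).trans ?_)
  rw [Real.volume_Icc, Real.volume_Icc, show t - η - -η = t by ring,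
    show η - (t + η) = -t by ring]
  rcases le_total 0 t with h0 | h0
  · rw [abs_of_nonneg h0, ENNReal.ofReal_of_nonpos (p := -t) (by linarith), add_zero]
  · rw [abs_of_nonpos h0, ENNReal.ofReal_of_nonpos (p := t) h0, zero_add]

theorem unif_map (η t : ℝ) :
    ((unif η).map (fun y => t + y)).restrict (ovl η t) = (unif η).restrict (ovl η t) := by
  ext s hs
  have hm : Measurable (fun y : ℝ => t + y) := by fun_prop
  rw [Measure.restrict_apply hs, Measure.restrict_apply hs,
    Measure.map_apply hm (hs.inter (ovl_meas η t))]
  simp only [unif, Measure.smul_apply, smul_eq_mul]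
  congr 1
  rw [Measure.restrict_apply (hm (hs.inter (ovl_meas η t))),
    Measure.restrict_apply (hs.inter (ovl_meas η t))]
  have h1 : (fun y : ℝ => t + y) ⁻¹' (s ∩ ovl η t) ∩ Set.Icc (-η) η
      = (fun y : ℝ => t + y) ⁻¹' (s ∩ ovl η t) := by
    apply Set.inter_eq_left.mpr
    rintro y ⟨_, _, h3⟩
    exact ⟨by linarith [h3.1], by linarith [h3.2]⟩
  have h2 : s ∩ ovl η t ∩ Set.Icc (-η) η = s ∩ ovl η t := by
    apply Set.inter_eq_left.mpr
    rintro y ⟨_, h3, _⟩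
    exact h3
  rw [h1, h2, measure_preimage_add]

theorem pi_shift {d : ℕ} {η : ℝ} (hη : 0 < η) (δ : Fin d → ℝ) (S : Set (Fin d → ℝ))
    (hS : MeasurableSet S) :
    (Measure.pi fun _ : Fin d => unif η) S ≤
      (Measure.pi fun _ : Fin d => unif η) {v | δ + v ∈ S}
        + ENNReal.ofReal ((∑ i, |δ i|) / (2 * η)) := by
  have := unif_prob hη
  set B : Set (Fin d → ℝ) := Set.univ.pi fun i => ovl η (δ i) with hB
  have hBm : MeasurableSet B := MeasurableSet.univ_pi fun i => ovl_meas _ _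
  have hm : Measurable (fun v : Fin d → ℝ => δ + v) := by fun_prop
  have hp : ∀ i, IsProbabilityMeasure ((unif η).map (fun y => δ i + y)) := fun i =>
    Measure.isProbabilityMeasure_map (by fun_prop)
  have hmap : (Measure.pi fun _ : Fin d => unif η).map (fun v => δ + v)
      = Measure.pi fun i => (unif η).map (fun y => δ i + y) :=
    Measure.pi_map_pi (μ := fun _ : Fin d => unif η) (f := fun i y => δ i + y)
      (fun i => by fun_prop)
  have hr : ((Measure.pi fun _ : Fin d => unif η).map (fun v => δ + v)).restrict B
      = (Measure.pi fun _ : Fin d => unif η).restrict B := by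
    rw [hmap, hB, Measure.restrict_pi_pi, Measure.restrict_pi_pi]
    simp only [unif_map]
  have h1 : (Measure.pi fun _ : Fin d => unif η) (S ∩ B) ≤
      (Measure.pi fun _ : Fin d => unif η) {v | δ + v ∈ S} := by
    rw [← Measure.restrict_apply hS, ← hr, Measure.restrict_apply hS,
      Measure.map_apply hm (hS.inter hBm)]
    exact measure_mono fun v hv => hv.1
  have h2 : (Measure.pi fun _ : Fin d => unif η) Bᶜ
      ≤ ENNReal.ofReal ((∑ i, |δ i|) / (2 * η)) := by
    have hsub : Bᶜ ⊆ ⋃ i, Function.eval i ⁻¹' (ovl η (δ i))ᶜ := by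
      intro v hv
      simpa [hB, Set.mem_pi] using hv
    refine (measure_mono hsub).trans ((measure_iUnion_fintype_le _ _).trans ?_)
    rw [Finset.sum_div, ENNReal.ofReal_sum_of_nonneg (fun i _ => by positivity)]
    refine Finset.sum_le_sum fun i _ => ?_
    rw [(measurePreserving_eval (fun _ : Fin d => unif η) i).measure_preimage
      (ovl_meas _ _).compl.nullMeasurableSet]
    exact unif_compl hη _
  calc _ ≤ (Measure.pi fun _ : Fin d => unif η) (S ∩ B ∪ Bᶜ) := by
        apply measure_mono
        intro v hv
        by_cases hvB : v ∈ B
        · exact Or.inl ⟨hv, hvB⟩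
        · exact Or.inr hvB
    _ ≤ _ := (measure_union_le _ _).trans (add_le_add h1 h2)

/-- Randomized smoothing with uniform noise on the cube `[−η, η]^d`: if the
base classifier `F` predicts class `k` at `x` with probability at least
`τ > 1/2`, then for every perturbation `δ` with `‖δ‖₁ < 2η(τ − 1/2)` class `k`
has probability `> 1/2` at `x + δ`, so the smoothed classifier predicts `k`
there — an ℓ₁ robustness certificate of radius `R = 2η(τ − 0.5)`. -/
theorem stmt_17 (d c : ℕ) (hd : 1 ≤ d) (hc : 1 ≤ c)
    (η τ : ℝ) (hη : 0 < η) (hτ : τ ∈ Set.Ioc (1 / 2 : ℝ) 1)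
    (F : (Fin d → ℝ) → Fin c) (hF : Measurable F)
    (μ : Measure (Fin d → ℝ))
    (hμ : μ = Measure.pi fun _ : Fin d =>
      (ENNReal.ofReal (2 * η))⁻¹ • volume.restrict (Set.Icc (-η) η))
    (x : Fin d → ℝ) (k : Fin c)
    (hk : ENNReal.ofReal τ ≤ μ {v | F (x + v) = k}) :
    ∀ δ : Fin d → ℝ, ∑ i, |δ i| < 2 * η * (τ - 1 / 2) →
      (1 / 2 : ℝ≥0∞) < μ {v | F (x + δ + v) = k} ∧
      ∀ j : Fin c, j ≠ k →
        μ {v | F (x + δ + v) = j} < μ {v | F (x + δ + v) = k} := by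
  intro δ hδ
  have hpi : μ = Measure.pi fun _ : Fin d => unif η := hμ
  have := unif_prob hη
  have hprob : IsProbabilityMeasure μ := by rw [hpi]; infer_instance
  have hmeas : ∀ (z : Fin d → ℝ) (j : Fin c), MeasurableSet {v | F (z + v) = j} := fun z j =>
    (hF.comp (by fun_prop : Measurable fun v : Fin d → ℝ => z + v)) (measurableSet_singleton j)
  have hmain : (1 / 2 : ℝ≥0∞) < μ {v | F (x + δ + v) = k} := by
    have h1 := pi_shift hη δ {v | F (x + v) = k} (hmeas x k)
    rw [← hpi] at h1
    simp only [Set.mem_setOf_eq, ← add_assoc] at h1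
    have h2 := hk.trans h1
    by_contra hcon
    have h3 := h2.trans (add_le_add_left (not_lt.mp hcon) _)
    rw [show (1 / 2 : ℝ≥0∞) = ENNReal.ofReal (1 / 2) by
      rw [ENNReal.ofReal_div_of_pos (by norm_num)]; simp,
      ← ENNReal.ofReal_add (by norm_num) (by positivity),
      ENNReal.ofReal_le_ofReal_iff (by positivity)] at h3
    have h4 : (∑ i, |δ i|) / (2 * η) < τ - 1 / 2 := by
      rw [div_lt_iff₀ (by positivity)]
      linarith
    linarith
  refine ⟨hmain, fun j hj => lt_of_le_of_lt ?_ hmain⟩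
  have hle : μ {v | F (x + δ + v) = j} ≤ μ {v | F (x + δ + v) = k}ᶜ :=
    measure_mono fun v hv hv2 => hj (hv.symm.trans hv2)
  refine hle.trans ?_
  rw [prob_compl_eq_one_sub (hmeas _ _), tsub_le_iff_right]
  calc (1 : ℝ≥0∞) = 1 / 2 + 1 / 2 := (ENNReal.add_halves 1).symm
    _ ≤ _ := add_le_add_right hmain.le _
end
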